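/- arXiv:1105.2019 — 3 statements merged into one kernel-verified Lean document; each statement's English description precedes it below -/
import Mathlib

section
/- Let n ≥ 1, ρ > 0, and let Δ : ℂ^n → ℂ^n be complex analytic on a neighborhood of the closed ball of radius ρ centered at 0, with Δ(0) = 0. Then there exist a diagonal n × n complex matrix D, a vector a ∈ ℂ^n, a radius ε > 0, and a closed subset R of the disk {λ ∈ ℂ : |λ| < ε} with empty interior (possibly empty), such that for every λ with |λ| < ε and λ ∉ R, the map Δ_λ : z ↦ Δ(z) + λ·(Dz + a) has only hyperbolic fixed points in the open ball of radius ρ/2: for every z with ‖z‖ < ρ/2 and Δ_λ(z) = z, the derivative of Δ_λ at z is an invertible ℂ-linear map having no eigenvalue of modulus 1. -/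
open Set Filter Topology MeasureTheory

/-- Projecting a closed set along a compact factor gives a closed set. -/
theorem IsClosed.setOf_exists_mem_compact {X Y : Type*} [TopologicalSpace X] [TopologicalSpace Y]
    {C : Set (X × Y)} (hC : IsClosed C) {s : Set Y} (hs : IsCompact s) :
    IsClosed {x | ∃ y ∈ s, (x, y) ∈ C} := by
  have : CompactSpace s := isCompact_iff_compactSpace.mp hs
  have h := isClosedMap_fst_of_compactSpace (X := X) (Y := s) _
    (hC.preimage (f := fun q : X × s => (q.1, (q.2 : Y))) (by fun_prop))
  convert h using 1
  ext x
  simp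

/-- The derivative of a holomorphic map on a finite-dimensional space is continuous. -/
theorem continuousOn_fderiv_of_differentiableOn_complex {E : Type*}
    [NormedAddCommGroup E] [NormedSpace ℂ E]
    [FiniteDimensional ℂ E] {F : Type*} [NormedAddCommGroup F] [NormedSpace ℂ F]
    {f : E → F} {U : Set E} (hU : IsOpen U) (hf : DifferentiableOn ℂ f U) :
    ContinuousOn (fderiv ℂ f) U := by
  have : ProperSpace E := FiniteDimensional.proper ℂ E
  rw [continuousOn_clm_apply]
  intro v z₀ hz₀
  apply ContinuousAt.continuousWithinAt
  obtain ⟨r, hr, hrU⟩ := Metric.isOpen_iff.mp hU z₀ hz₀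
  have hsub : Metric.closedBall z₀ (r / 2) ⊆ U :=
    (Metric.closedBall_subset_ball (by linarith)).trans hrU
  have huc := (isCompact_closedBall z₀ (r / 2)).uniformContinuousOn_of_continuous
    (hf.continuousOn.mono hsub)
  rw [Metric.uniformContinuousOn_iff] at huc
  rw [Metric.continuousAt_iff]
  intro ε hε
  set ρ : ℝ := r / 4 / (‖v‖ + 1) with hρdef
  have hv : 0 < ‖v‖ + 1 := by positivity
  have hρ : 0 < ρ := by positivity
  have hρv : ρ * ‖v‖ ≤ r / 4 := by
    rw [hρdef, div_mul_eq_mul_div, div_le_iff₀ hv]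
    nlinarith [norm_nonneg v]
  obtain ⟨δ, hδ, H⟩ := huc (ε / 2 * ρ) (by positivity)
  refine ⟨min δ (r / 4), by positivity, fun {z} hz => ?_⟩
  have hzδ : dist z z₀ < δ := hz.trans_le (min_le_left _ _)
  have hzr : dist z z₀ < r / 4 := hz.trans_le (min_le_right _ _)
  have hmem : ∀ w, dist w z₀ ≤ r / 4 → ∀ t : ℂ, ‖t‖ ≤ ρ →
      w + t • v ∈ Metric.closedBall z₀ (r / 2) := by
    intro w hw t ht
    rw [Metric.mem_closedBall, dist_eq_norm] at *
    have h1 : ‖t • v‖ ≤ r / 4 := by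
      rw [norm_smul]
      exact (mul_le_mul_of_nonneg_right ht (norm_nonneg v)).trans hρv
    have h2 : w + t • v - z₀ = (w - z₀) + t • v := by abel
    rw [h2]
    linarith [norm_add_le (w - z₀) (t • v)]
  have hder : ∀ w, dist w z₀ ≤ r / 4 → ∀ t : ℂ, ‖t‖ ≤ ρ →
      HasDerivAt (fun t : ℂ => f (w + t • v)) (fderiv ℂ f (w + t • v) v) t := by
    intro w hw t ht
    have h1 : HasFDerivAt f (fderiv ℂ f (w + t • v)) (w + t • v) :=
      (hf.differentiableAt (hU.mem_nhds (hsub (hmem w hw t ht)))).hasFDerivAt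
    have h2 : HasDerivAt (fun t : ℂ => w + t • v) v t := by
      simpa using ((hasDerivAt_id t).smul_const v).const_add w
    exact h1.comp_hasDerivAt t h2
  have hd : ∀ t : ℂ, ‖t‖ ≤ ρ → HasDerivAt (fun t : ℂ => f (z + t • v) - f (z₀ + t • v))
      (fderiv ℂ f (z + t • v) v - fderiv ℂ f (z₀ + t • v) v) t := fun t ht =>
    (hder z hzr.le t ht).sub (hder z₀ (by simp; positivity) t ht)
  have hcauchy := Complex.norm_deriv_le_of_forall_mem_sphere_norm_le (c := 0) (C := ε / 2 * ρ) hρ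
    (f := fun t : ℂ => f (z + t • v) - f (z₀ + t • v))
    (DifferentiableOn.diffContOnCl fun t ht => by
      rw [closure_ball _ hρ.ne', mem_closedBall_zero_iff] at ht
      exact (hd t ht).differentiableAt.differentiableWithinAt)
    (fun t ht => by
      have ht' : ‖t‖ ≤ ρ := (mem_sphere_zero_iff_norm.mp ht).le
      rw [← dist_eq_norm]
      exact (H _ (hmem z hzr.le t ht') _ (hmem z₀ (by simp; positivity) t ht')
        (by simpa using hzδ)).le)
  rw [(hd 0 (by simpa using hρ.le)).deriv, mul_div_cancel_right₀ _ hρ.ne'] at hcauchy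
  rw [dist_eq_norm]
  simp only [zero_smul, add_zero] at hcauchy
  linarith

/-- Together with the unit circle, `0` makes up the set of forbidden multipliers of a hyperbolic
fixed point. -/
def nonhyperbolicMultipliers : Set ℂ := insert 0 (Metric.sphere 0 1)

theorem isCompact_nonhyperbolicMultipliers : IsCompact nonhyperbolicMultipliers :=
  (isCompact_sphere 0 1).insert 0

theorem volume_nonhyperbolicMultipliers : volume nonhyperbolicMultipliers = 0 := by
  rw [nonhyperbolicMultipliers, insert_eq, measure_union_null_iff]
  exact ⟨measure_singleton _, Measure.addHaar_sphere _ _ _⟩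

/-- Pairs `(z, t)`, with `z` in `B`, such that `A z + t` is a non-hyperbolic endomorphism. -/
def nonhyperbolicPairs {E : Type*} [NormedAddCommGroup E] [NormedSpace ℂ E]
    (A : E → E →L[ℂ] E) (B : Set E) : Set (E × ℂ) :=
  {p | p.1 ∈ B ∧ ∃ μ ∈ nonhyperbolicMultipliers, μ - p.2 ∈ spectrum ℂ (A p.1)}

theorem isClosed_nonhyperbolicPairs {E : Type*} [NormedAddCommGroup E] [NormedSpace ℂ E]
    [CompleteSpace E] {A : E → E →L[ℂ] E} {B : Set E}
    (hB : IsClosed B) (hA : ContinuousOn A B) : IsClosed (nonhyperbolicPairs A B) := by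
  have hcont : ContinuousOn (fun q : (E × ℂ) × ℂ =>
      algebraMap ℂ (E →L[ℂ] E) (q.2 - q.1.2) - A q.1.1) {q | q.1.1 ∈ B} := by
    refine ContinuousOn.sub (Continuous.continuousOn ?_) (hA.comp (by fun_prop) fun q hq => hq)
    exact (continuous_algebraMap ℂ (E →L[ℂ] E)).comp (by fun_prop)
  have hC := hcont.preimage_isClosed_of_isClosed (hB.preimage (by fun_prop))
    (nonunits.isClosed (R := E →L[ℂ] E))
  convert hC.setOf_exists_mem_compact isCompact_nonhyperbolicMultipliers using 1
  ext p
  simp only [nonhyperbolicPairs, spectrum.mem_iff, mem_ofPred_eq, mem_inter_iff, mem_preimage,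
    mem_nonunits_iff]
  tauto

theorem measure_nonhyperbolicPairs {E : Type*} [NormedAddCommGroup E] [NormedSpace ℂ E]
    [FiniteDimensional ℂ E] [MeasurableSpace E] [BorelSpace E] (ν : Measure E) [SFinite ν]
    {A : E → E →L[ℂ] E} {B : Set E}
    (hB : IsClosed B) (hA : ContinuousOn A B) :
    (ν.prod volume) (nonhyperbolicPairs A B) = 0 := by
  have : CompleteSpace E := FiniteDimensional.complete ℂ E
  have : ProperSpace E := FiniteDimensional.proper ℂ E
  refine Measure.measure_prod_null_of_ae_null
    (isClosed_nonhyperbolicPairs hB hA).measurableSet (Eventually.of_forall fun z => ?_)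
  have hfin : (spectrum ℂ (A z)).Finite := by
    rw [ContinuousLinearMap.spectrum_eq]
    exact Module.End.finite_spectrum _
  refine measure_mono_null (t := ⋃ s ∈ spectrum ℂ (A z),
    (fun t => t + s) ⁻¹' nonhyperbolicMultipliers) ?_ ?_
  · rintro t ⟨-, μ, hμ, hs⟩
    exact mem_biUnion hs (by simpa using hμ)
  · rw [measure_biUnion_null_iff hfin.countable]
    intro s _
    rw [measure_preimage_add_right, volume_nonhyperbolicMultipliers]

/-- The parameters `(a, t)` for which `z ↦ f z + (t • z + a)` has a non-hyperbolic fixed point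
in `B`. -/
def nonhyperbolicParameters {E : Type*} [NormedAddCommGroup E] [NormedSpace ℂ E]
    (f : E → E) (B : Set E) : Set (E × ℂ) :=
  (fun p : E × ℂ => (p.1 - f p.1 - p.2 • p.1, p.2)) '' nonhyperbolicPairs (fderiv ℂ f) B

theorem isClosed_nonhyperbolicParameters {E : Type*} [NormedAddCommGroup E] [NormedSpace ℂ E]
    [FiniteDimensional ℂ E] {f : E → E} {B U : Set E} (hB : IsCompact B)
    (hU : IsOpen U) (hBU : B ⊆ U) (hf : DifferentiableOn ℂ f U) :
    IsClosed (nonhyperbolicParameters f B) := by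
  have : CompleteSpace E := FiniteDimensional.complete ℂ E
  have hA := (continuousOn_fderiv_of_differentiableOn_complex hU hf).mono hBU
  have hK := isClosed_nonhyperbolicPairs hB.isClosed hA
  have hcont : ContinuousOn (fun q : (E × ℂ) × E =>
      q.2 - f q.2 - q.1.2 • q.2 - q.1.1) {q | q.2 ∈ B} := by
    have h : ContinuousOn (fun q : (E × ℂ) × E => f q.2) {q | q.2 ∈ B} :=
      (hf.continuousOn.mono hBU).comp (by fun_prop) fun q hq => hq
    exact ((continuousOn_snd.sub h).sub (by fun_prop)).sub (by fun_prop)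
  have hC := hcont.preimage_isClosed_of_isClosed (hB.isClosed.preimage (by fun_prop))
    (isClosed_singleton (x := (0 : E)))
  have hC' := hC.inter (hK.preimage (f := fun q : (E × ℂ) × E => (q.2, q.1.2)) (by fun_prop))
  convert hC'.setOf_exists_mem_compact hB using 1
  ext ⟨a, t⟩
  simp only [nonhyperbolicParameters, mem_image, Prod.exists, Prod.mk.injEq, mem_ofPred_eq,
    mem_inter_iff, mem_preimage, mem_singleton_iff, sub_eq_zero]
  constructor
  · rintro ⟨z, t', hz, h, rfl⟩
    exact ⟨z, hz.1, ⟨hz.1, h⟩, hz⟩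
  · rintro ⟨z, -, ⟨-, h⟩, hz⟩
    exact ⟨z, t, hz, h, rfl⟩

theorem measure_nonhyperbolicParameters {E : Type*} [NormedAddCommGroup E] [NormedSpace ℂ E]
    [FiniteDimensional ℂ E] [MeasurableSpace E] [BorelSpace E] (ν : Measure E) [ν.IsAddHaarMeasure]
    {f : E → E} {B U : Set E} (hB : IsCompact B)
    (hU : IsOpen U) (hBU : B ⊆ U) (hf : DifferentiableOn ℂ f U) :
    (ν.prod volume) (nonhyperbolicParameters f B) = 0 := by
  have : ProperSpace E := FiniteDimensional.proper ℂ E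
  refine addHaar_image_eq_zero_of_differentiableOn_of_addHaar_eq_zero _ ?_
    (measure_nonhyperbolicPairs ν hB.isClosed
      ((continuousOn_fderiv_of_differentiableOn_complex hU hf).mono hBU))
  intro p hp
  have h1 : DifferentiableAt ℂ f p.1 := hf.differentiableAt (hU.mem_nhds (hBU hp.1))
  have h2 : DifferentiableAt ℂ (fun p : E × ℂ => (p.1 - f p.1 - p.2 • p.1, p.2)) p := by
    fun_prop
  exact (h2.restrictScalars ℝ).differentiableWithinAt

/-- Almost every complex line through the origin meets a closed null set in a null set. -/
theorem ae_measure_preimage_smul_eq_zero {E : Type*} [NormedAddCommGroup E] [NormedSpace ℂ E]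
    [FiniteDimensional ℝ E] [MeasurableSpace E] [BorelSpace E] (ν : Measure E) [ν.IsAddHaarMeasure]
    {N : Set E} (hN : IsClosed N) (h0 : ν N = 0) : ∀ᵐ p ∂ν, volume {c : ℂ | c • p ∈ N} = 0 := by
  have : ProperSpace E := FiniteDimensional.proper ℝ E
  have hmeas : MeasurableSet {x : ℂ × E | x.1 • x.2 ∉ N} :=
    ((hN.preimage (f := fun x : ℂ × E => x.1 • x.2) (by fun_prop)).isOpen_compl).measurableSet
  have h : ∀ᵐ c : ℂ, ∀ᵐ p ∂ν, c • p ∉ N := by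
    have hne : ∀ᵐ c : ℂ, c ≠ 0 := by simp [ae_iff]
    filter_upwards [hne] with c hc
    rw [ae_iff]
    have hset : {p | ¬ c • p ∉ N} = (fun p : E => c⁻¹ • p) '' N := by
      ext p
      simp only [not_not, mem_ofPred_eq, mem_image]
      exact ⟨fun hp => ⟨_, hp, inv_smul_smul₀ hc p⟩, by rintro ⟨q, hq, rfl⟩; simpa [hc] using hq⟩
    rw [hset]
    exact addHaar_image_eq_zero_of_differentiableOn_of_addHaar_eq_zero _
      (by fun_prop) h0
  rw [Measure.ae_ae_comm hmeas] at h
  filter_upwards [h] with p hp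
  simpa [ae_iff] using hp

/-- **Generic hyperbolicity of fixed points via a linear perturbation**
(Lemma 2.3 of the paper). Let `Δ : ℂⁿ → ℂⁿ` be holomorphic on an open neighborhood `U`
of the closed ball of radius `ρ` with `Δ 0 = 0`. Then there are a diagonal matrix `D`,
a vector `a`, a radius `ε > 0` and a relatively closed subset `R` of the disk
`{|λ| < ε}` with empty interior, such that for every `λ` in the disk outside `R` the
map `z ↦ Δ z + λ • (D z + a)` has only hyperbolic fixed points in the ball of radius
`ρ / 2`: at each fixed point the derivative is bijective and has no eigenvalue of
modulus `1`. -/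
theorem exists_perturbation_hyperbolic_fixed_points (n : ℕ) (hn : 1 ≤ n) (ρ : ℝ)
    (hρ : 0 < ρ) (Δ : (Fin n → ℂ) → (Fin n → ℂ)) (U : Set (Fin n → ℂ))
    (hU : IsOpen U) (hball : Metric.closedBall 0 ρ ⊆ U)
    (hΔ : DifferentiableOn ℂ Δ U) (hΔ0 : Δ 0 = 0) :
    ∃ (D : Matrix (Fin n) (Fin n) ℂ) (a : Fin n → ℂ) (ε : ℝ) (R : Set ℂ),
      D.IsDiag ∧ 0 < ε ∧ R ⊆ Metric.ball (0 : ℂ) ε ∧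
      IsOpen (Metric.ball (0 : ℂ) ε \ R) ∧ interior R = ∅ ∧
      ∀ lam : ℂ, ‖lam‖ < ε → lam ∉ R →
        ∀ z : Fin n → ℂ, ‖z‖ < ρ / 2 →
          Δ z + lam • (D.mulVec z + a) = z →
          Function.Bijective
            (fderiv ℂ (fun w => Δ w + lam • (D.mulVec w + a)) z) ∧
          ∀ μ : ℂ,
            Module.End.HasEigenvalue
              ((fderiv ℂ (fun w => Δ w + lam • (D.mulVec w + a)) z :
                (Fin n → ℂ) →ₗ[ℂ] (Fin n → ℂ))) μ → ‖μ‖ ≠ 1 := by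
  have : (volume : Measure (Fin n → ℂ)).IsAddHaarMeasure :=
    inferInstanceAs (Measure.pi fun _ => volume).IsAddHaarMeasure
  set B : Set (Fin n → ℂ) := Metric.closedBall 0 (ρ / 2)
  have hB : IsCompact B := isCompact_closedBall _ _
  have hBU : B ⊆ U := (Metric.closedBall_subset_closedBall (by linarith)).trans hball
  have hclosed := isClosed_nonhyperbolicParameters hB hU hBU hΔ
  obtain ⟨⟨a, d⟩, hp⟩ := (ae_measure_preimage_smul_eq_zero (volume.prod volume) hclosed
    (measure_nonhyperbolicParameters volume hB hU hBU hΔ)).exists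
  set C : Set ℂ := {c : ℂ | c • (a, d) ∈ nonhyperbolicParameters Δ B}
  have hC : IsClosed C := hclosed.preimage (by fun_prop)
  refine ⟨Matrix.diagonal fun _ => d, a, 1, Metric.ball 0 1 ∩ C, Matrix.isDiag_diagonal _,
    one_pos, inter_subset_left, ?_, ?_, ?_⟩
  · rw [sdiff_self_inter]
    exact Metric.isOpen_ball.sdiff hC
  · exact volume.interior_eq_empty_of_null (measure_mono_null inter_subset_right hp)
  intro lam hlam hR z hz hfix
  have hmul : ∀ w, (Matrix.diagonal fun _ : Fin n => d).mulVec w = d • w := fun w => by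
    ext i; simp [Matrix.mulVec_diagonal]
  have hzB : z ∈ B := mem_closedBall_zero_iff.mpr hz.le
  simp only [hmul] at hfix ⊢
  have hderiv : fderiv ℂ (fun w => Δ w + lam • (d • w + a)) z
      = fderiv ℂ Δ z + algebraMap ℂ _ (lam * d) := by
    have h1 := (hΔ.differentiableAt (hU.mem_nhds (hBU hzB))).hasFDerivAt
    have h2 := h1.add ((((hasFDerivAt_id (𝕜 := ℂ) z).const_smul d).add_const a).const_smul lam)
    refine HasFDerivAt.fderiv (h2.congr_fderiv ?_)
    ext v i
    simp [Algebra.algebraMap_eq_smul_one, mul_assoc]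
  rw [hderiv]
  have hspec : ∀ μ ∈ nonhyperbolicMultipliers,
      μ ∉ spectrum ℂ (fderiv ℂ Δ z + algebraMap ℂ _ (lam * d)) := by
    intro μ hμ hs
    refine hR ⟨mem_ball_zero_iff.mpr hlam, (z, lam * d), ⟨hzB, μ, hμ, ?_⟩, ?_⟩
    · rw [spectrum.mem_iff] at hs ⊢
      rwa [map_sub, sub_sub, add_comm (algebraMap ℂ _ (lam * d))]
    · simp only [Prod.smul_mk, smul_eq_mul, Prod.mk.injEq, and_true]
      nth_rewrite 1 [← hfix]
      rw [smul_add, smul_smul]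
      abel
  refine ⟨?_, fun μ hμ h1 => ?_⟩
  · have h0 := hspec 0 (mem_insert _ _)
    rwa [spectrum.zero_notMem_iff, ContinuousLinearMap.isUnit_iff_bijective] at h0
  · refine hspec μ (mem_insert_of_mem _ (mem_sphere_zero_iff_norm.mpr h1)) ?_
    rw [ContinuousLinearMap.spectrum_eq]
    exact hμ.mem_spectrum
end

section
/- Let X be a topological space, Y a Hausdorff topological space, f : X → Y continuous, A ⊆ X compact, and B ⊆ A a subset such that f(A \ B) is open in Y. Then the topological frontier (boundary) of f(A) in Y is contained in f(B). -/
/-- **Boundary points of the image of a compact set.** Let `f : X → Y` be continuous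
with `Y` Hausdorff, `A ⊆ X` compact and `B ⊆ A` such that `f '' (A \ B)` is open in
`Y`. Then the frontier of `f '' A` is contained in `f '' B`. -/
theorem frontier_image_subset {X Y : Type*} [TopologicalSpace X] [TopologicalSpace Y]
    [T2Space Y] (f : X → Y) (hf : Continuous f) (A B : Set X) (hA : IsCompact A)
    (hBA : B ⊆ A) (hopen : IsOpen (f '' (A \ B))) :
    frontier (f '' A) ⊆ f '' B := by
  rintro y ⟨hy, hy_int⟩
  rw [(hA.image hf).isClosed.closure_eq] at hy
  obtain ⟨x, hxA, rfl⟩ := hy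
  by_contra hxB
  exact hy_int (interior_maximal (Set.image_mono Set.sdiff_subset) hopen
    ⟨x, ⟨hxA, fun hx ↦ hxB ⟨x, hx, rfl⟩⟩, rfl⟩)
end

section
/- Let U ⊆ ℂ^k and V ⊆ ℂ^m be open sets and let f : ℂ^k → ℂ^d and g : ℂ^m → ℂ^d be complex analytic on U and V respectively. Then for (Lebesgue) almost every a ∈ ℂ^d, the translate of f by a meets g transversally: for all x ∈ U and y ∈ V with f(x) + a = g(y), the ranges of the complex derivatives satisfy range(Df(x)) + range(Dg(y)) = ℂ^d. -/
open MeasureTheory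

open Set Filter Topology Metric

section Holomorphic

variable {E Y : Type*} [NormedAddCommGroup E] [NormedSpace ℂ E] [FiniteDimensional ℂ E]
  [NormedAddCommGroup Y] [NormedSpace ℂ Y] [FiniteDimensional ℂ Y]

/-- Cauchy's formula for a directional derivative, differentiated under the integral sign. -/
theorem differentiableAt_fderiv_apply_of_eventually {f : E → Y} {p : E}
    (hf : ∀ᶠ x in 𝓝 p, DifferentiableAt ℂ f x) (v : E) :
    DifferentiableAt ℂ (fun x => fderiv ℂ f x v) p := by
  have hE : CompleteSpace E := FiniteDimensional.complete ℂ E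
  have hY : CompleteSpace Y := FiniteDimensional.complete ℂ Y
  have hPE : ProperSpace E := FiniteDimensional.proper ℂ E
  have hPY : ProperSpace Y := FiniteDimensional.proper ℂ Y
  borelize E Y
  obtain ⟨R, hR, hball⟩ := Metric.eventually_nhds_iff_ball.1
    (hf.and (hf.self_of_nhds.continuousAt.eventually (ball_mem_nhds (f p) one_pos)))
  have hdiff : ∀ x ∈ ball p R, DifferentiableAt ℂ f x := fun x hx => (hball x hx).1
  have hval : ∀ x ∈ ball p R, f x ∈ ball (f p) 1 := fun x hx => (hball x hx).2
  have hbound : ∀ x ∈ ball p (R / 2), ‖fderiv ℂ f x‖ ≤ 2 / (R / 2) := by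
    intro x hx
    have hsub : ball x (R / 2) ⊆ ball p R := by
      refine ball_subset_ball' ?_
      have := mem_ball.1 hx
      linarith
    refine Complex.norm_fderiv_le_div_of_mapsTo_ball
      (fun y hy => (hdiff y (hsub hy)).differentiableWithinAt) ?_ (by positivity)
    intro y hy
    have h1 := mem_ball.1 (hval y (hsub hy))
    have h2 := mem_ball.1 (hval x (hsub (mem_ball_self (by positivity))))
    refine mem_closedBall.2 ?_
    have := dist_triangle_right (f y) (f x) (f p)
    linarith
  set ρ : ℝ := R / (4 * (‖v‖ + 1)) with hρ
  have hρ0 : 0 < ρ := by positivity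
  have hρv : ρ * ‖v‖ < R / 4 := by
    have : ρ * (‖v‖ + 1) = R / 4 := by rw [hρ]; field_simp
    nlinarith
  have hmem : ∀ x ∈ ball p (R / 4), ∀ z : ℂ, ‖z‖ ≤ ρ → x + z • v ∈ ball p (R / 2) := by
    intro x hx z hz
    have h1 := mem_ball_iff_norm.1 hx
    have h2 : ‖z • v‖ ≤ ρ * ‖v‖ := by rw [norm_smul]; gcongr
    rw [mem_ball_iff_norm, add_sub_right_comm]
    have := norm_add_le (x - p) (z • v)
    linarith
  have hhalf : ball p (R / 2) ⊆ ball p R := ball_subset_ball (by linarith)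
  have hcirc : ∀ θ : ℝ, ‖circleMap 0 ρ θ‖ ≤ ρ := fun θ => by
    rw [norm_circleMap_zero, abs_of_pos hρ0]
  let c : ℝ → ℂ := fun θ => deriv (circleMap 0 ρ) θ * ((circleMap 0 ρ θ - 0) ^ 2)⁻¹
  have hc : Continuous c := by
    have h0 : ∀ θ : ℝ, (circleMap 0 ρ θ - 0) ^ 2 ≠ 0 := fun θ => by
      simpa using hρ0.ne'
    simp only [c, deriv_circleMap]
    exact ((continuous_circleMap 0 ρ).mul continuous_const).mul
      ((((continuous_circleMap 0 ρ).sub continuous_const).pow 2).inv₀ h0)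
  have hshift : ∀ x ∈ ball p (R / 4), Continuous (fun θ : ℝ => f (x + circleMap 0 ρ θ • v)) := by
    intro x hx
    refine continuous_iff_continuousAt.2 fun θ => ?_
    refine ContinuousAt.comp (f := fun θ : ℝ => x + circleMap 0 ρ θ • v) (g := f)
      (hdiff _ (hhalf (hmem x hx _ (hcirc θ)))).continuousAt ?_
    exact (continuous_const.add
      ((continuous_circleMap 0 ρ).smul continuous_const)).continuousAt
  have hformula : ∀ x ∈ ball p (R / 4), fderiv ℂ f x v =
      (2 * Real.pi * Complex.I : ℂ)⁻¹ •
        ∫ θ in (0 : ℝ)..(2 * Real.pi), c θ • f (x + circleMap 0 ρ θ • v) := by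
    intro x hx
    have hline : Continuous (fun t : ℂ => x + t • v) := by fun_prop
    have hU : IsOpen ((fun t : ℂ => x + t • v) ⁻¹' ball p (R / 2)) := isOpen_ball.preimage hline
    have hd : DifferentiableOn ℂ (fun t : ℂ => f (x + t • v))
        ((fun t : ℂ => x + t • v) ⁻¹' ball p (R / 2)) := by
      intro t ht
      refine DifferentiableAt.differentiableWithinAt ?_
      exact DifferentiableAt.comp t (hdiff _ (hhalf ht)) (by fun_prop)
    have h := Complex.cderiv_eq_deriv hU hd hρ0 (z := 0) (fun t ht =>
      hmem x hx t (by simpa using ht))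
    have hder : deriv (fun t : ℂ => f (x + t • v)) 0 = fderiv ℂ f x v := by
      have h0 : HasFDerivAt f (fderiv ℂ f x) (x + (0 : ℂ) • v) := by
        simpa using (hdiff x (ball_subset_ball (by linarith) hx)).hasFDerivAt
      have h1 : HasDerivAt (fun t : ℂ => x + t • v) v 0 := by
        simpa using ((hasDerivAt_id (0 : ℂ)).smul_const v).const_add x
      exact (h0.comp_hasDerivAt (0 : ℂ) h1).deriv
    rw [← hder, ← h, Complex.cderiv, circleIntegral]
    simp only [c, smul_smul]
  have hmain : HasFDerivAt
      (fun x => ∫ θ in (0 : ℝ)..(2 * Real.pi), c θ • f (x + circleMap 0 ρ θ • v))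
      (∫ θ in (0 : ℝ)..(2 * Real.pi), c θ • fderiv ℂ f (p + circleMap 0 ρ θ • v)) p := by
    have hp : p ∈ ball p (R / 4) := mem_ball_self (by positivity)
    refine intervalIntegral.hasFDerivAt_integral_of_dominated_of_fderiv_le
      (F' := fun x θ => c θ • fderiv ℂ f (x + circleMap 0 ρ θ • v))
      (bound := fun θ => ‖c θ‖ * (2 / (R / 2)))
      (ball_mem_nhds p (show 0 < R / 4 by positivity)) ?_ ?_ ?_ ?_ ?_ ?_
    · filter_upwards [ball_mem_nhds p (show 0 < R / 4 by positivity)] with x hx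
      exact (hc.smul (hshift x hx)).aestronglyMeasurable
    · exact (hc.smul (hshift p hp)).intervalIntegrable _ _
    · refine hc.aestronglyMeasurable.smul ?_
      refine Measurable.aestronglyMeasurable ?_
      exact (measurable_fderiv ℂ f).comp (continuous_const.add
        ((continuous_circleMap 0 ρ).smul continuous_const)).measurable
    · refine Eventually.of_forall fun θ _ x hx => ?_
      rw [norm_smul]
      gcongr
      exact hbound _ (hmem x hx _ (hcirc θ))
    · exact (hc.norm.mul continuous_const).intervalIntegrable _ _
    · refine Eventually.of_forall fun θ _ x hx => ?_
      refine HasFDerivAt.const_smul ?_ (c θ)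
      have h0 := (hdiff _ (hhalf (hmem x hx _ (hcirc θ)))).hasFDerivAt
      exact h0.comp x ((hasFDerivAt_id x).add_const (circleMap 0 ρ θ • v))
  refine (hmain.differentiableAt.const_smul (2 * Real.pi * Complex.I : ℂ)⁻¹).congr_of_eventuallyEq ?_
  filter_upwards [ball_mem_nhds p (show 0 < R / 4 by positivity)] with x hx
  exact hformula x hx

theorem contDiffAt_one_of_eventually_differentiableAt {f : E → Y} {p : E}
    (hf : ∀ᶠ x in 𝓝 p, DifferentiableAt ℂ f x) : ContDiffAt ℂ 1 f p := by
  obtain ⟨s, hs, hso, hp⟩ := _root_.eventually_nhds_iff.1 hf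
  have h : ContDiffOn ℂ 1 f s := by
    rw [show (1 : WithTop ℕ∞) = 0 + 1 from (zero_add 1).symm,
      contDiffOn_succ_iff_fderiv_of_isOpen hso]
    refine ⟨fun x hx => (hs x hx).differentiableWithinAt, by simp, ?_⟩
    rw [contDiffOn_zero]
    refine continuousOn_clm_apply.2 fun v x hx => ?_
    exact (differentiableAt_fderiv_apply_of_eventually
      (eventually_of_mem (hso.mem_nhds hx) hs) v).continuousAt.continuousWithinAt
  exact h.contDiffAt (hso.mem_nhds hp)

end Holomorphic

theorem measure_image_null_of_locally_null {X Y : Type*} [TopologicalSpace X]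
    [SecondCountableTopology X] [MeasurableSpace Y] (μ : Measure Y) (F : X → Y) (A : Set X)
    (h : ∀ x ∈ A, ∃ N ∈ 𝓝 x, μ (F '' (A ∩ N)) = 0) : μ (F '' A) = 0 := by
  have key := measure_null_of_locally_null (μ := OuterMeasure.comap F μ.toOuterMeasure) A
    fun x hx => by
      obtain ⟨N, hN, h0⟩ := h x hx
      exact ⟨A ∩ N, inter_mem self_mem_nhdsWithin (mem_nhdsWithin_of_mem_nhds hN), by simpa using h0⟩
  simpa using key

/-- The rectification of a submersion: near `q` the map `g` is the first projection in the
holomorphic coordinates `φ`. -/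
theorem exists_holomorphic_rectification {E Z : Type*} [NormedAddCommGroup E] [NormedSpace ℂ E]
    [FiniteDimensional ℂ E] [NormedAddCommGroup Z] [NormedSpace ℂ Z] [FiniteDimensional ℂ Z]
    {g : E → Z} {q : E} (hg : ∀ᶠ x in 𝓝 q, DifferentiableAt ℂ g x)
    (hsurj : Function.Surjective (fderiv ℂ g q)) {U : Set E} (hU : U ∈ 𝓝 q) :
    ∃ (b : Z × (fderiv ℂ g q).ker) (Ω : Set (Z × (fderiv ℂ g q).ker))
      (φ : Z × (fderiv ℂ g q).ker → E), IsOpen Ω ∧ b ∈ Ω ∧ φ b = q ∧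
      (∀ p ∈ Ω, DifferentiableAt ℂ φ p) ∧ (∀ p ∈ Ω, g (φ p) = p.1) ∧ MapsTo φ Ω U ∧
      ∀ N ∈ 𝓝 b, φ '' N ∈ 𝓝 q := by
  have hE : CompleteSpace E := FiniteDimensional.complete ℂ E
  have hZ : CompleteSpace Z := FiniteDimensional.complete ℂ Z
  have hcd := contDiffAt_one_of_eventually_differentiableAt hg
  have hstrict := hcd.hasStrictFDerivAt one_ne_zero
  let I := HasStrictFDerivAt.implicitFunctionDataOfComplemented g (fderiv ℂ g q) hstrict
    (LinearMap.range_eq_top.2 hsurj)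
    (ContinuousLinearMap.ker_closedComplemented_of_finiteDimensional_range _)
  have hr : ContDiffAt ℂ 1 I.rightFun I.pt := by
    change ContDiffAt ℂ 1 (fun x => I.rightDeriv (x - q)) q
    exact I.rightDeriv.contDiff.contDiffAt.comp q (contDiffAt_id.sub contDiffAt_const)
  have hψ : ContDiffAt ℂ 1 I.implicitFunction.uncurry (I.prodFun I.pt) :=
    ImplicitFunctionData.contDiffAt_implicitFunction hcd hr one_ne_zero
  have hb : I.implicitFunction.uncurry (I.prodFun I.pt) = q :=
    I.implicitFunction_apply_image.self_of_nhds
  have hUev : ∀ᶠ p in 𝓝 (I.prodFun I.pt), I.implicitFunction.uncurry p ∈ U := by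
    refine hψ.continuousAt.eventually ?_
    rw [hb]
    exact hU
  obtain ⟨Ω, hΩ, hΩo, hbΩ⟩ := _root_.eventually_nhds_iff.1
    (((hψ.eventually (by simp)).and I.leftFun_implicitFunction).and hUev)
  refine ⟨I.prodFun I.pt, Ω, I.implicitFunction.uncurry, hΩo, hbΩ, hb,
    fun p hp => (hΩ p hp).1.1.differentiableAt one_ne_zero, fun p hp => (hΩ p hp).1.2,
    fun p hp => (hΩ p hp).2, fun N hN => ?_⟩
  have hcont : ContinuousAt I.prodFun q := hcd.continuousAt.prodMk hr.continuousAt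
  filter_upwards [I.implicitFunction_apply_image, hcont hN] with x hx hxN
  exact ⟨I.prodFun x, hxN, hx⟩

theorem exists_nhds_image_zero_set_null_of_iteratedDeriv_ne_zero {E Y : Type*} [NormedAddCommGroup E]
    [NormedSpace ℂ E] [FiniteDimensional ℂ E] [MeasurableSpace Y] {μ : Measure Y} {F : E → Y}
    {A : Set E}
    (hA : ∀ (u : E → ℂ), ∀ q ∈ A, (∀ᶠ x in 𝓝 q, DifferentiableAt ℂ u x) → fderiv ℂ u q ≠ 0 →
      ∃ N ∈ 𝓝 q, μ (F '' ((A ∩ {x | u x = 0}) ∩ N)) = 0) {p v : E} (m : ℕ) :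
    ∀ u : E → ℂ, (∀ᶠ x in 𝓝 p, DifferentiableAt ℂ u x) →
      iteratedDeriv m (fun t : ℂ => u (p + t • v)) 0 ≠ 0 →
      ∃ N ∈ 𝓝 p, μ (F '' ((A ∩ {x | u x = 0}) ∩ N)) = 0 := by
  induction m with
  | zero =>
    intro u hu h0
    have hp : u p ≠ 0 := by simpa using h0
    refine ⟨{x | u x ≠ 0}, hu.self_of_nhds.continuousAt.eventually_ne hp, ?_⟩
    have : (A ∩ {x | u x = 0}) ∩ {x | u x ≠ 0} = ∅ := by
      ext x
      simp +contextual
    simp [this]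
  | succ m ih =>
    intro u hu hm
    have hline : ContinuousAt (fun t : ℂ => p + t • v) 0 := by fun_prop
    have hderiv : deriv (fun t : ℂ => u (p + t • v)) =ᶠ[𝓝 0]
        fun t : ℂ => fderiv ℂ u (p + t • v) v := by
      have : ∀ᶠ t : ℂ in 𝓝 0, DifferentiableAt ℂ u (p + t • v) :=
        hline.eventually (by simpa using hu)
      filter_upwards [this] with t ht
      have h1 : HasDerivAt (fun t : ℂ => p + t • v) v t := by
        simpa using ((hasDerivAt_id t).smul_const v).const_add p
      exact (ht.hasFDerivAt.comp_hasDerivAt t h1).deriv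
    rw [iteratedDeriv_succ', hderiv.iteratedDeriv_eq] at hm
    obtain ⟨N, hN, hN0⟩ := ih (fun x => fderiv ℂ u x v)
      (hu.eventually_nhds.mono fun x hx => differentiableAt_fderiv_apply_of_eventually hx v) hm
    refine ⟨N ∩ {x | ∀ᶠ y in 𝓝 x, DifferentiableAt ℂ u y}, inter_mem hN hu.eventually_nhds, ?_⟩
    have hreg : μ (F '' {x ∈ A | u x = 0 ∧ (∀ᶠ y in 𝓝 x, DifferentiableAt ℂ u y) ∧
        fderiv ℂ u x v ≠ 0}) = 0 := by
      refine measure_image_null_of_locally_null μ F _ fun x hx => ?_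
      obtain ⟨N', hN', h0⟩ := hA u x hx.1 hx.2.2.1 fun h => hx.2.2.2 (by simp [h])
      refine ⟨N', hN', measure_mono_null (image_mono ?_) h0⟩
      rintro y ⟨⟨hyA, hy0, -⟩, hyN⟩
      exact ⟨⟨hyA, hy0⟩, hyN⟩
    refine measure_mono_null ?_ (measure_union_null hN0 hreg)
    rw [← image_union]
    refine image_mono ?_
    rintro x ⟨⟨hxA, hx0⟩, hxN, hxd⟩
    by_cases hx : fderiv ℂ u x v = 0
    · exact Or.inl ⟨⟨hxA, hx⟩, hxN⟩
    · exact Or.inr ⟨hxA, hx0, hxd, hx⟩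

/-- A holomorphic function that does not vanish identically near `p` has a nonzero iterated
directional derivative at `p`. -/
theorem exists_iteratedDeriv_line_ne_zero {E : Type*} [NormedAddCommGroup E] [NormedSpace ℂ E]
    {u : E → ℂ} {p : E} {r : ℝ}
    (hu : ∀ x ∈ ball p (2 * r), DifferentiableAt ℂ u x) {y : E} (hy : y ∈ ball p r)
    (huy : u y ≠ 0) :
    ∃ m : ℕ, iteratedDeriv m (fun t : ℂ => u (p + t • (y - p))) 0 ≠ 0 := by
  by_contra! hzero
  have hmem : ∀ t ∈ ball (0 : ℂ) 2, p + t • (y - p) ∈ ball p (2 * r) := by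
    intro t ht
    rw [mem_ball_iff_norm] at hy ⊢
    rw [mem_ball_zero_iff] at ht
    rw [add_sub_cancel_left, norm_smul]
    exact mul_lt_mul'' ht hy (norm_nonneg _) (norm_nonneg _)
  have hd : DifferentiableOn ℂ (fun t : ℂ => u (p + t • (y - p))) (ball 0 2) := fun t ht =>
    ((hu _ (hmem t ht)).comp t
      (f := fun t : ℂ => p + t • (y - p)) (by fun_prop)).differentiableWithinAt
  have h1 := Complex.taylorSeries_eq_on_ball' (r := 2) (z := 1) (by simp) hd
  simp only [hzero] at h1
  exact huy (by simpa using h1.symm)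

theorem exists_nhds_image_zero_set_null {E Y : Type*} [NormedAddCommGroup E]
    [NormedSpace ℂ E] [FiniteDimensional ℂ E] [MeasurableSpace Y]
    {V : Type*} [NormedAddCommGroup V] [NormedSpace ℂ V]
    {μ : Measure Y} {F : E → Y} {A : Set E}
    (hA : ∀ (u : E → ℂ), ∀ q ∈ A, (∀ᶠ x in 𝓝 q, DifferentiableAt ℂ u x) → fderiv ℂ u q ≠ 0 →
      ∃ N ∈ 𝓝 q, μ (F '' ((A ∩ {x | u x = 0}) ∩ N)) = 0) {p : E} {h : E → V}
    (hh : ∀ᶠ x in 𝓝 p, DifferentiableAt ℂ h x) (hne : ¬ ∀ᶠ x in 𝓝 p, h x = 0) :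
    ∃ N ∈ 𝓝 p, μ (F '' ((A ∩ {x | h x = 0}) ∩ N)) = 0 := by
  obtain ⟨r, hr, hball⟩ := Metric.eventually_nhds_iff_ball.1 hh
  obtain ⟨y, hy, hhy⟩ : ∃ y ∈ ball p (r / 2), h y ≠ 0 := by
    by_contra! hc
    exact hne (eventually_of_mem (ball_mem_nhds p (half_pos hr)) hc)
  obtain ⟨l, hl⟩ := SeparatingDual.exists_ne_zero (R := ℂ) hhy
  obtain ⟨m, hm⟩ := exists_iteratedDeriv_line_ne_zero (u := fun x => l (h x)) (r := r / 2)
    (fun x hx => l.differentiableAt.comp x (hball x (by simpa [mul_div_cancel₀] using hx))) hy hl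
  obtain ⟨N, hN, h0⟩ := exists_nhds_image_zero_set_null_of_iteratedDeriv_ne_zero hA m
    (fun x => l (h x)) (hh.mono fun x hx => l.differentiableAt.comp x hx) hm
  refine ⟨N, hN, measure_mono_null (image_mono ?_) h0⟩
  rintro x ⟨⟨hxA, hx0⟩, hxN⟩
  have hx0' : h x = 0 := hx0
  exact ⟨⟨hxA, show l (h x) = 0 by simp [hx0']⟩, hxN⟩

section NullCriticalValues

variable {Y : Type} [NormedAddCommGroup Y] [NormedSpace ℂ Y] [MeasurableSpace Y]

/-- Holomorphic maps from `n`-dimensional spaces have null sets of critical values. -/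
def CriticalValuesNull (μ : Measure Y) (n : ℕ) : Prop :=
  ∀ (E : Type) [NormedAddCommGroup E] [NormedSpace ℂ E] [FiniteDimensional ℂ E],
    Module.finrank ℂ E = n → ∀ U : Set E, IsOpen U → ∀ F : E → Y, DifferentiableOn ℂ F U →
      μ (F '' {x ∈ U | ¬ Function.Surjective (fderiv ℂ F x)}) = 0

variable {E : Type} [NormedAddCommGroup E] [NormedSpace ℂ E] [FiniteDimensional ℂ E]

theorem exists_nhds_critical_image_hypersurface_null {μ : Measure Y} {F : E → Y} {U : Set E}
    (hU : IsOpen U) (hF : DifferentiableOn ℂ F U)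
    (ih : ∀ n < Module.finrank ℂ E, CriticalValuesNull μ n) {u : E → ℂ} {q : E} (hq : q ∈ U)
    (hu : ∀ᶠ x in 𝓝 q, DifferentiableAt ℂ u x) (hdu : fderiv ℂ u q ≠ 0) :
    ∃ N ∈ 𝓝 q,
      μ (F '' (({x ∈ U | ¬ Function.Surjective (fderiv ℂ F x)} ∩ {x | u x = 0}) ∩ N)) = 0 := by
  have hsurj : Function.Surjective (fderiv ℂ u q) :=
    LinearMap.surjective (f := (fderiv ℂ u q : E →ₗ[ℂ] ℂ)) fun h => hdu (by
      ext x
      exact LinearMap.congr_fun h x)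
  obtain ⟨b, Ω, φ, hΩ, hbΩ, hφb, hφ, huφ, hφU, hN⟩ :=
    exists_holomorphic_rectification hu hsurj (hU.mem_nhds hq)
  have hdim : Module.finrank ℂ (fderiv ℂ u q).ker < Module.finrank ℂ E := by
    have h1 := LinearMap.finrank_range_add_finrank_ker (fderiv ℂ u q : E →ₗ[ℂ] ℂ)
    have h2 : LinearMap.range (fderiv ℂ u q : E →ₗ[ℂ] ℂ) = ⊤ := LinearMap.range_eq_top.2 hsurj
    rw [h2, finrank_top, Module.finrank_self] at h1
    omega
  have hinr : ∀ z : (fderiv ℂ u q).ker,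
      HasFDerivAt (fun w : (fderiv ℂ u q).ker => ((0 : ℂ), w)) (.inr ℂ ℂ _) z :=
    fun z => (ContinuousLinearMap.inr ℂ ℂ (fderiv ℂ u q).ker).hasFDerivAt
  have hslice : ∀ z : (fderiv ℂ u q).ker, ((0 : ℂ), z) ∈ Ω →
      HasFDerivAt (fun w : (fderiv ℂ u q).ker => F (φ (0, w)))
        ((fderiv ℂ F (φ (0, z))).comp ((fderiv ℂ φ (0, z)).comp (.inr ℂ ℂ _))) z := by
    intro z hz
    have h1 := (hF.differentiableAt (hU.mem_nhds (hφU hz))).hasFDerivAt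
    have h2 := (hφ _ hz).hasFDerivAt.comp z (hinr z)
    exact h1.comp z h2
  refine ⟨φ '' Ω, hN Ω (hΩ.mem_nhds hbΩ), measure_mono_null ?_ (ih _ hdim (fderiv ℂ u q).ker rfl
    {z | ((0 : ℂ), z) ∈ Ω} (hΩ.preimage (by fun_prop)) (fun w => F (φ (0, w)))
    fun z hz => (hslice z hz).differentiableAt.differentiableWithinAt)⟩
  rintro _ ⟨_, ⟨⟨⟨_, hcrit⟩, hu0⟩, ⟨⟨t, z⟩, hp, rfl⟩⟩, rfl⟩
  obtain rfl : t = 0 := (huφ _ hp).symm.trans hu0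
  refine ⟨z, ⟨hp, fun hs => hcrit ?_⟩, rfl⟩
  rw [(hslice z hp).fderiv, ContinuousLinearMap.coe_comp] at hs
  exact hs.of_comp

theorem exists_nhds_image_null_of_fderiv_inr_eq_zero {Z K : Type} [NormedAddCommGroup Z]
    [NormedSpace ℂ Z] [FiniteDimensional ℂ Z] [NormedAddCommGroup K] [NormedSpace ℂ K]
    [FiniteDimensional ℂ K] [FiniteDimensional ℂ Y] [BorelSpace Y] (μ : Measure Y)
    [μ.IsAddHaarMeasure] {G : Z × K → Y} {p : Z × K} (hZ : Module.finrank ℂ Z < Module.finrank ℂ Y)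
    (hG : ∀ᶠ x in 𝓝 p, DifferentiableAt ℂ G x)
    (hflat : ∀ᶠ x in 𝓝 p, ∀ w : K, fderiv ℂ G x (0, w) = 0) :
    ∃ N ∈ 𝓝 p, μ (G '' N) = 0 := by
  obtain ⟨r, hr, hball⟩ := Metric.eventually_nhds_iff_ball.1 (hG.eventually_nhds.and hflat)
  have hprod : ∀ {x : Z × K}, x ∈ ball p r ↔ x.1 ∈ ball p.1 r ∧ x.2 ∈ ball p.2 r := by
    intro x
    rw [← mem_prod, ball_prod_same]
  refine ⟨ball p r, ball_mem_nhds p hr, ?_⟩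
  have hconst : ∀ x ∈ ball p r, G x = G (x.1, p.2) := by
    rintro ⟨t, z⟩ hx
    obtain ⟨ht, hz⟩ := hprod.1 hx
    have hd : ∀ w ∈ ball p.2 r, HasFDerivAt (fun w => G (t, w)) (0 : K →L[ℂ] Y) w := by
      intro w hw
      have hm := hball (t, w) (hprod.2 ⟨ht, hw⟩)
      have h1 := hm.1.self_of_nhds.hasFDerivAt.comp w (hasFDerivAt_prodMk_right t w)
      convert! h1 using 1
      ext w'
      exact (hm.2 w').symm
    exact isOpen_ball.is_const_of_fderiv_eq_zero (𝕜 := ℂ) (convex_ball p.2 r).isPreconnected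
      (fun w hw => (hd w hw).differentiableAt.differentiableWithinAt)
      (fun w hw => (hd w hw).fderiv) hz (mem_ball_self hr)
  have himage : G '' ball p r ⊆ (fun t => G (t, p.2)) '' ball p.1 r := by
    rintro _ ⟨x, hx, rfl⟩
    exact ⟨x.1, (hprod.1 hx).1, (hconst x hx).symm⟩
  refine measure_mono_null himage ?_
  have hcd : ContDiffOn ℝ 1 (fun t => G (t, p.2)) (ball p.1 r) := by
    intro t ht
    have hm := (hball (t, p.2) (hprod.2 ⟨ht, mem_ball_self hr⟩)).1
    have h1 : ContDiffAt ℂ 1 (fun t => G (t, p.2)) t :=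
      (contDiffAt_one_of_eventually_differentiableAt hm).comp t
        (contDiffAt_id.prodMk contDiffAt_const)
    exact (h1.restrict_scalars ℝ).contDiffWithinAt
  have hdimH : dimH ((fun t => G (t, p.2)) '' ball p.1 r) ≤ Module.finrank ℝ Z :=
    (hcd.dimH_image_le (convex_ball p.1 r) subset_rfl).trans
      ((dimH_mono (subset_univ _)).trans_eq (Real.dimH_univ_eq_finrank Z))
  refine measure_zero_of_dimH_lt (d := Module.finrank ℝ Y) ?_ (hdimH.trans_lt ?_)
  · simpa using Measure.absolutelyContinuous_isAddHaarMeasure μ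
      (Measure.hausdorffMeasure (Module.finrank ℝ Y : ℝ))
  · rw [finrank_real_of_complex, finrank_real_of_complex]
    exact_mod_cast Nat.mul_lt_mul_of_pos_left hZ two_pos

theorem exists_nhds_image_constant_rank_null [FiniteDimensional ℂ Y] [BorelSpace Y]
    (μ : Measure Y) [μ.IsAddHaarMeasure]
    (ih : ∀ n < Module.finrank ℂ E, CriticalValuesNull μ n) {F : E → Y} {U : Set E}
    (hU : IsOpen U) (hF : DifferentiableOn ℂ F U) {q : E} (hq : q ∈ U)
    (hcrit : ¬ Function.Surjective (fderiv ℂ F q)) :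
    ∃ N ∈ 𝓝 q, μ (F '' ({x ∈ U |
      Module.finrank ℂ (fderiv ℂ F x).range = Module.finrank ℂ (fderiv ℂ F q).range} ∩ N)) = 0 := by
  have hFd : ∀ x ∈ U, DifferentiableAt ℂ F x := fun x hx => hF.differentiableAt (hU.mem_nhds hx)
  obtain ⟨π, hπ⟩ := Submodule.ClosedComplemented.of_finiteDimensional (fderiv ℂ F q).range
  have hRY : Module.finrank ℂ (fderiv ℂ F q).range < Module.finrank ℂ Y :=
    Submodule.finrank_lt fun h => hcrit (LinearMap.range_eq_top.1 h)
  have hg : ∀ x ∈ U, HasFDerivAt (fun x => π (F x)) (π.comp (fderiv ℂ F x)) x :=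
    fun x hx => π.hasFDerivAt.comp x (hFd x hx).hasFDerivAt
  have hgsurj : Function.Surjective (fderiv ℂ (fun x => π (F x)) q) := by
    rw [(hg q hq).fderiv]
    rintro ⟨_, x, rfl⟩
    exact ⟨x, hπ ⟨_, x, rfl⟩⟩
  obtain ⟨b, Ω, φ, hΩ, hbΩ, hφb, hφ, hgφ, hφU, hN⟩ := exists_holomorphic_rectification
    (eventually_of_mem (hU.mem_nhds hq) fun x hx => (hg x hx).differentiableAt) hgsurj
    (hU.mem_nhds hq)
  have hdim : Module.finrank ℂ ((fderiv ℂ F q).range × (fderiv ℂ (fun x => π (F x)) q).ker) =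
      Module.finrank ℂ E := by
    have h1 := LinearMap.finrank_range_add_finrank_ker
      (fderiv ℂ (fun x => π (F x)) q : E →ₗ[ℂ] (fderiv ℂ F q).range)
    rwa [LinearMap.range_eq_top.2 hgsurj, finrank_top, ← Module.finrank_prod] at h1
  generalize (fderiv ℂ (fun x => π (F x)) q).ker = K at *
  have hG : ∀ p ∈ Ω, HasFDerivAt (fun p => F (φ p))
      ((fderiv ℂ F (φ p)).comp (fderiv ℂ φ p)) p :=
    fun p hp => (hFd _ (hφU hp)).hasFDerivAt.comp p (hφ p hp).hasFDerivAt
  have hπG : ∀ p ∈ Ω, ∀ y, π (fderiv ℂ F (φ p) (fderiv ℂ φ p y)) = y.1 := by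
    intro p hp y
    have h1 := π.hasFDerivAt.comp p (hG p hp)
    have h2 : HasFDerivAt (fun p => π (F (φ p))) (.fst ℂ (fderiv ℂ F q).range K) p :=
      hasFDerivAt_fst.congr_of_eventuallyEq (eventually_of_mem (hΩ.mem_nhds hp) hgφ)
    exact DFunLike.congr_fun (h1.unique h2) y
  have hflat : ∀ p ∈ Ω,
      Module.finrank ℂ (fderiv ℂ F (φ p)).range = Module.finrank ℂ (fderiv ℂ F q).range →
      ∀ w : K, fderiv ℂ (fun p => F (φ p)) p (0, w) = 0 := by
    intro p hp hrank w
    let πr : (fderiv ℂ F (φ p)).range →ₗ[ℂ] (fderiv ℂ F q).range :=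
      (π : Y →ₗ[ℂ] (fderiv ℂ F q).range).comp (Submodule.subtype _)
    have hsurj : Function.Surjective πr := fun z =>
      ⟨⟨_, fderiv ℂ φ p (z, 0), rfl⟩, hπG p hp (z, 0)⟩
    have hinj : Function.Injective πr :=
      (LinearMap.injective_iff_surjective_of_finrank_eq_finrank hrank).2 hsurj
    have h0 : (⟨_, fderiv ℂ φ p (0, w), rfl⟩ : (fderiv ℂ F (φ p)).range) = 0 :=
      hinj ((hπG p hp (0, w)).trans (map_zero πr).symm)
    rw [(hG p hp).fderiv]
    exact congrArg Subtype.val h0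
  have hGev : ∀ᶠ p in 𝓝 b, DifferentiableAt ℂ (fun p => F (φ p)) p :=
    eventually_of_mem (hΩ.mem_nhds hbΩ) fun p hp => (hG p hp).differentiableAt
  have hkey : ∃ N ∈ 𝓝 b, μ ((fun p => F (φ p)) '' ({p ∈ Ω | φ p ∈ {x ∈ U |
      Module.finrank ℂ (fderiv ℂ F x).range = Module.finrank ℂ (fderiv ℂ F q).range}} ∩ N)) = 0 := by
    by_cases hall : ∀ w : K, ∀ᶠ p in 𝓝 b, fderiv ℂ (fun p => F (φ p)) p (0, w) = 0
    · have hall' : ∀ᶠ p in 𝓝 b, ∀ w : K, fderiv ℂ (fun p => F (φ p)) p (0, w) = 0 := by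
        have hB := eventually_all.2 fun i => hall (Module.finBasis ℂ K i)
        filter_upwards [hB] with p hp w
        have : ((fderiv ℂ (fun p => F (φ p)) p : _ →ₗ[ℂ] Y).comp
            (LinearMap.inr ℂ (fderiv ℂ F q).range K)) = 0 :=
          (Module.finBasis ℂ K).ext fun i => hp i
        exact LinearMap.congr_fun this w
      obtain ⟨N, hN, h0⟩ := exists_nhds_image_null_of_fderiv_inr_eq_zero μ hRY hGev hall'
      exact ⟨N, hN, measure_mono_null (image_mono inter_subset_right) h0⟩
    · obtain ⟨w, hw⟩ := not_forall.1 hall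
      have hGΩ : DifferentiableOn ℂ (fun p => F (φ p)) Ω :=
        fun p hp => (hG p hp).differentiableAt.differentiableWithinAt
      obtain ⟨N, hN, h0⟩ := exists_nhds_image_zero_set_null (μ := μ) (F := fun p => F (φ p))
        (fun u p hp hu hdu => exists_nhds_critical_image_hypersurface_null hΩ hGΩ
          (by rwa [hdim]) hp.1 hu hdu)
        (hGev.eventually_nhds.mono fun p hp => differentiableAt_fderiv_apply_of_eventually hp
          ((0 : (fderiv ℂ F q).range), w)) hw
      refine ⟨N, hN, measure_mono_null (image_mono ?_) h0⟩
      rintro p ⟨⟨hp, -, hrank⟩, hpN⟩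
      refine ⟨⟨⟨hp, fun hs => ?_⟩, hflat p hp hrank w⟩, hpN⟩
      rw [(hG p hp).fderiv, ContinuousLinearMap.coe_comp] at hs
      have htop : (fderiv ℂ F (φ p)).range = ⊤ := LinearMap.range_eq_top.2 hs.of_comp
      rw [htop, finrank_top] at hrank
      exact hRY.ne' hrank
  obtain ⟨N, hNb, h0⟩ := hkey
  refine ⟨φ '' (Ω ∩ N), hN _ (inter_mem (hΩ.mem_nhds hbΩ) hNb), measure_mono_null ?_ h0⟩
  rintro _ ⟨_, ⟨hx, ⟨p, ⟨hpΩ, hpN⟩, rfl⟩⟩, rfl⟩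
  exact ⟨p, ⟨⟨hpΩ, hx⟩, hpN⟩, rfl⟩

/-- **Sard's theorem** for holomorphic maps between finite-dimensional complex spaces. -/
theorem criticalValuesNull [FiniteDimensional ℂ Y] [BorelSpace Y] (μ : Measure Y)
    [μ.IsAddHaarMeasure] (n : ℕ) : CriticalValuesNull μ n := by
  induction n using Nat.strong_induction_on with
  | _ n ih =>
    intro E _ _ _ hn U hU F hF
    subst hn
    have hPE : ProperSpace E := FiniteDimensional.proper ℂ E
    have hcover : F '' {x ∈ U | ¬ Function.Surjective (fderiv ℂ F x)} ⊆
        ⋃ r : ℕ, F '' {x ∈ U | ¬ Function.Surjective (fderiv ℂ F x) ∧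
          Module.finrank ℂ (fderiv ℂ F x).range = r} := by
      rintro _ ⟨x, ⟨hx, hc⟩, rfl⟩
      exact mem_iUnion.2 ⟨_, x, ⟨hx, hc, rfl⟩, rfl⟩
    refine measure_mono_null hcover (measure_iUnion_null fun r => ?_)
    refine measure_image_null_of_locally_null μ F _ fun q hq => ?_
    obtain ⟨hqU, hqc, hqr⟩ := hq
    obtain ⟨N, hN, h0⟩ := exists_nhds_image_constant_rank_null μ ih hU hF hqU hqc
    refine ⟨N, hN, measure_mono_null (image_mono ?_) h0⟩
    rintro x ⟨⟨hxU, -, hxr⟩, hxN⟩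
    exact ⟨⟨hxU, hxr.trans hqr.symm⟩, hxN⟩

end NullCriticalValues

/-- **Sard-type generic transversality under translations.** Let `f` and `g` be
holomorphic on open sets `U ⊆ ℂᵏ` and `V ⊆ ℂᵐ` with values in `ℂᵈ`. For Lebesgue-almost
every `a ∈ ℂᵈ`, whenever `f x + a = g y` with `x ∈ U`, `y ∈ V`, the ranges of the
derivatives `Df(x)` and `Dg(y)` together span `ℂᵈ`. -/
theorem ae_translate_transversal (k m d : ℕ)
    (U : Set (Fin k → ℂ)) (hU : IsOpen U)
    (V : Set (Fin m → ℂ)) (hV : IsOpen V)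
    (f : (Fin k → ℂ) → (Fin d → ℂ)) (hf : DifferentiableOn ℂ f U)
    (g : (Fin m → ℂ) → (Fin d → ℂ)) (hg : DifferentiableOn ℂ g V) :
    ∀ᵐ a : Fin d → ℂ ∂volume,
      ∀ x ∈ U, ∀ y ∈ V, f x + a = g y →
        LinearMap.range ((fderiv ℂ f x) : (Fin k → ℂ) →ₗ[ℂ] (Fin d → ℂ)) ⊔
          LinearMap.range ((fderiv ℂ g y) : (Fin m → ℂ) →ₗ[ℂ] (Fin d → ℂ)) = ⊤ := by
  have hd : ∀ p ∈ U ×ˢ V, HasFDerivAt (fun p : (Fin k → ℂ) × (Fin m → ℂ) => g p.2 - f p.1)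
      ((fderiv ℂ g p.2).comp (.snd ℂ _ _) - (fderiv ℂ f p.1).comp (.fst ℂ _ _)) p := by
    intro p hp
    exact ((hg.differentiableAt (hV.mem_nhds hp.2)).hasFDerivAt.comp p hasFDerivAt_snd).sub
      ((hf.differentiableAt (hU.mem_nhds hp.1)).hasFDerivAt.comp p hasFDerivAt_fst)
  have hnull := criticalValuesNull (volume : Measure (Fin d → ℂ)) _
    ((Fin k → ℂ) × (Fin m → ℂ)) rfl (U ×ˢ V) (hU.prod hV) (fun p => g p.2 - f p.1)
    fun p hp => (hd p hp).differentiableAt.differentiableWithinAt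
  refine measure_mono_null (fun a ha => ?_) hnull
  by_contra hna
  refine ha fun x hx y hy hxy => ?_
  have hs : Function.Surjective
      (fderiv ℂ (fun p : (Fin k → ℂ) × (Fin m → ℂ) => g p.2 - f p.1) (x, y)) := by
    by_contra hs
    exact hna ⟨(x, y), ⟨⟨hx, hy⟩, hs⟩, by simp [← hxy]⟩
  rw [(hd (x, y) ⟨hx, hy⟩).fderiv] at hs
  refine eq_top_iff.2 fun z _ => ?_
  obtain ⟨⟨v, w⟩, rfl⟩ := hs z
  refine Submodule.mem_sup.2 ⟨fderiv ℂ f x (-v), ⟨-v, rfl⟩, fderiv ℂ g y w, ⟨w, rfl⟩, ?_⟩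
  simp [sub_eq_neg_add]
end
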